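/- Let S ∈ TOEC. If every point of the boundary set ∂_S is separated, then I_S = Z[p_S]. -/

import Mathlib

open MeasureTheory Metric Set Pointwise

noncomputable section

/-- An iterated function system (IFS) of contracting similarities on `ℝ^d`. -/
structure IFS (d : ℕ) : Type 1 where
  ι : Type
  fin : Fintype ι
  f : ι → EuclideanSpace ℝ (Fin d) → EuclideanSpace ℝ (Fin d)
  r : ι → ℝ
  r_pos : ∀ i, 0 < r i
  r_lt_one : ∀ i, r i < 1
  sim : ∀ i x y, dist (f i x) (f i y) = r i * dist x y

attribute [instance] IFS.fin

namespace IFS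

variable {d : ℕ}

/-- `E` is the self-similar set (attractor) of `S`: the unique nonempty compact set
with `E = ⋃ i, S.f i '' E`. -/
def IsAttractor (S : IFS d) (E : Set (EuclideanSpace ℝ (Fin d))) : Prop :=
  E.Nonempty ∧ IsCompact E ∧ E = ⋃ i, S.f i '' E

open scoped Classical in
/-- The self-similar set generated by `S`. -/
def attractor (S : IFS d) : Set (EuclideanSpace ℝ (Fin d)) :=
  if h : ∃ E, S.IsAttractor E then h.choose else ∅

/-- `O` is an open set witnessing the open set condition for `S`. -/
def OSCSet (S : IFS d) (O : Set (EuclideanSpace ℝ (Fin d))) : Prop :=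
  O.Nonempty ∧ IsOpen O ∧ Bornology.IsBounded O ∧
    (∀ i, S.f i '' O ⊆ O) ∧ ∀ i j, i ≠ j → Disjoint (S.f i '' O) (S.f j '' O)

/-- The open set condition. -/
def OSC (S : IFS d) : Prop := ∃ O, S.OSCSet O

/-- The strong separation condition. -/
def SSC (S : IFS d) : Prop :=
  ∀ i j : S.ι, i ≠ j → Disjoint (S.f i '' S.attractor) (S.f j '' S.attractor)

/-- `r` is the ratio root of `S`: the ratios are commensurable with common root `r`. -/
def IsRatioRoot (S : IFS d) (r : ℝ) : Prop :=
  0 < r ∧ r < 1 ∧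
    ∃ lam : S.ι → ℕ, (∀ i, 0 < lam i) ∧ (∀ i, S.r i = r ^ lam i) ∧ Finset.univ.gcd lam = 1

/-- The Hausdorff dimension of the attractor of `S`, as a real number. -/
def hdim (S : IFS d) : ℝ := (dimH S.attractor).toReal

/-- Membership in the class TOEC: OSC, commensurable ratios, totally disconnected attractor. -/
def MemTOEC (S : IFS d) : Prop :=
  S.OSC ∧ (∃ r, S.IsRatioRoot r) ∧ IsTotallyDisconnected S.attractor

/-- Membership in TOEC(p, r): measure root `p` and ratio root `r`. -/
def MemTOECpr (S : IFS d) (p r : ℝ) : Prop :=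
  S.MemTOEC ∧ S.IsRatioRoot r ∧ p = r ^ S.hdim

/-- The natural measure of a set: normalized `s`-dimensional Hausdorff measure, `s = dimH E_S`. -/
def natMeasure (S : IFS d) (F : Set (EuclideanSpace ℝ (Fin d))) : ℝ :=
  (μH[S.hdim] F / μH[S.hdim] S.attractor).toReal

/-- `F` is an interior separated set of `E_S`. -/
def IsIntSep (S : IFS d) (F : Set (EuclideanSpace ℝ (Fin d))) : Prop :=
  IsCompact F ∧ F ⊆ S.attractor ∧ IsCompact (S.attractor \ F) ∧ ∃ O, S.OSCSet O ∧ F ⊆ O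

end IFS

/-- The subring `ℤ[p]` of `ℝ` generated by `ℤ` and `p`. -/
def Zring (p : ℝ) : Subring ℝ := Subring.closure {p}

/-- The underlying set of reals of an ideal of a subring of `ℝ`. -/
def idealSet {R : Subring ℝ} (I : Ideal R) : Set ℝ := (fun x : R => (x : ℝ)) '' (I : Set R)

/-- The ideal `I_S` of `ℤ[p]` generated by the natural measures of interior separated sets. -/
def IFS.idealOf {d : ℕ} (S : IFS d) (p : ℝ) : Ideal (Zring p) :=
  Ideal.span {x : Zring p | ∃ F, S.IsIntSep F ∧ (x : ℝ) = S.natMeasure F}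

/-- Two ideals of a subring `R` of `ℝ` lie in the same ideal class: `a·I = b·J`
for some nonzero `a, b ∈ R`. -/
def SameIdealClass {R : Subring ℝ} (I J : Ideal R) : Prop :=
  ∃ a b : R, a ≠ 0 ∧ b ≠ 0 ∧ (a : ℝ) • idealSet I = (b : ℝ) • idealSet J

/-- Lipschitz equivalence of subsets of (possibly different) metric spaces. -/
def LipEquiv {X Y : Type*} [MetricSpace X] [MetricSpace Y] (A : Set X) (B : Set Y) : Prop :=
  ∃ (f : X → Y) (L : ℝ), 1 ≤ L ∧ Set.BijOn f A B ∧
    ∀ x ∈ A, ∀ y ∈ A, L⁻¹ * dist x y ≤ dist (f x) (f y) ∧ dist (f x) (f y) ≤ L * dist x y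

/-- The composition `S_w = S_{i_1} ∘ ⋯ ∘ S_{i_n}` along a finite word `w = i_1 … i_n`. -/
def IFS.compWord {d : ℕ} (S : IFS d) (w : List S.ι) :
    EuclideanSpace ℝ (Fin d) → EuclideanSpace ℝ (Fin d) :=
  w.foldr (fun i g => S.f i ∘ g) id

/-- The boundary set `∂_S = E_S \ ⋃ {O : O satisfies the OSC for S}`. -/
def IFS.boundary {d : ℕ} (S : IFS d) : Set (EuclideanSpace ℝ (Fin d)) :=
  S.attractor \ ⋃ O ∈ {O | S.OSCSet O}, O

/-- A point `x ∈ ∂_S` is separated: there is a finite word `w` with `S_w(x) ∉ ∂_S`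
and `S_w(x) ∉ S_{w'}(E_S)` for every word `w'` of the same length as `w` with
`w' ≠ w`. -/
def IFS.SeparatedPt {d : ℕ} (S : IFS d) (x : EuclideanSpace ℝ (Fin d)) : Prop :=
  ∃ w : List S.ι, S.compWord w x ∉ S.boundary ∧
    ∀ w' : List S.ι, w'.length = w.length → w' ≠ w →
      S.compWord w x ∉ S.compWord w' '' S.attractor

namespace IFS

open Filter Topology
open scoped NNReal ENNReal

variable {d : ℕ} (S : IFS d)

/-! ### Similarities along words -/

/-- The contraction ratio of `S.compWord w`. -/
def wordRatio (w : List S.ι) : ℝ := (w.map S.r).prod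

@[simp]
theorem wordRatio_nil : S.wordRatio [] = 1 := rfl

@[simp]
theorem wordRatio_cons (i : S.ι) (w : List S.ι) :
    S.wordRatio (i :: w) = S.r i * S.wordRatio w := by
  simp [wordRatio]

@[simp]
theorem wordRatio_append (v w : List S.ι) :
    S.wordRatio (v ++ w) = S.wordRatio v * S.wordRatio w := by
  simp [wordRatio]

theorem wordRatio_pos (w : List S.ι) : 0 < S.wordRatio w := by
  induction w with
  | nil => simp
  | cons i w ih => simpa using mul_pos (S.r_pos i) ih

@[simp]
theorem compWord_nil : S.compWord [] = id := rfl

@[simp]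
theorem compWord_cons (i : S.ι) (w : List S.ι) :
    S.compWord (i :: w) = S.f i ∘ S.compWord w := rfl

theorem compWord_append (v w : List S.ι) :
    S.compWord (v ++ w) = S.compWord v ∘ S.compWord w := by
  induction v with
  | nil => rfl
  | cons i v ih => rw [List.cons_append, compWord_cons, ih, compWord_cons, Function.comp_assoc]

theorem dist_compWord (w : List S.ι) (x y : EuclideanSpace ℝ (Fin d)) :
    dist (S.compWord w x) (S.compWord w y) = S.wordRatio w * dist x y := by
  induction w with
  | nil => simp
  | cons i w ih => simp [S.sim, ih, mul_assoc]

theorem edist_compWord (w : List S.ι) (x y : EuclideanSpace ℝ (Fin d)) :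
    edist (S.compWord w x) (S.compWord w y) = ENNReal.ofReal (S.wordRatio w) * edist x y := by
  rw [edist_dist, edist_dist, dist_compWord, ENNReal.ofReal_mul (S.wordRatio_pos w).le]

theorem compWord_singleton (i : S.ι) : S.compWord [i] = S.f i := rfl

theorem wordRatio_singleton (i : S.ι) : S.wordRatio [i] = S.r i := by simp

theorem compWord_injective (w : List S.ι) : Function.Injective (S.compWord w) := by
  intro x y h
  have := S.dist_compWord w x y
  rw [h, dist_self] at this
  exact dist_eq_zero.1 ((mul_eq_zero.1 this.symm).resolve_left (S.wordRatio_pos w).ne')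

theorem lipschitzWith_compWord (w : List S.ι) :
    LipschitzWith (S.wordRatio w).toNNReal (S.compWord w) :=
  fun x y => (S.edist_compWord w x y).le

theorem antilipschitzWith_compWord (w : List S.ι) :
    AntilipschitzWith (S.wordRatio w)⁻¹.toNNReal (S.compWord w) := by
  intro x y
  have h := S.wordRatio_pos w
  change _ ≤ ENNReal.ofReal _ * _
  rw [edist_compWord, ← mul_assoc, ← ENNReal.ofReal_mul (by positivity), inv_mul_cancel₀ h.ne']
  simp

theorem continuous_compWord (w : List S.ι) : Continuous (S.compWord w) :=
  (S.lipschitzWith_compWord w).continuous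

theorem injective_f (i : S.ι) : Function.Injective (S.f i) := S.compWord_injective [i]

theorem continuous_f (i : S.ι) : Continuous (S.f i) := S.continuous_compWord [i]

/-- A similarity of ratio `ρ` scales `H^s` by `ρ^s`. -/
theorem hausdorffMeasure_compWord_image (w : List S.ι) {s : ℝ} (hs : 0 ≤ s)
    (A : Set (EuclideanSpace ℝ (Fin d))) :
    μH[s] (S.compWord w '' A) = ENNReal.ofReal (S.wordRatio w ^ s) * μH[s] A := by
  have h := S.wordRatio_pos w
  apply le_antisymm
  · refine ((S.lipschitzWith_compWord w).hausdorffMeasure_image_le hs A).trans_eq ?_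
    rw [← ENNReal.ofReal_rpow_of_pos h]
    rfl
  · have := (S.antilipschitzWith_compWord w).le_hausdorffMeasure_image hs A
    calc _ ≤ ENNReal.ofReal (S.wordRatio w ^ s) *
          (((S.wordRatio w)⁻¹.toNNReal : ℝ≥0∞) ^ s * μH[s] (S.compWord w '' A)) := by gcongr
      _ = _ := by
        change _ * (ENNReal.ofReal _ ^ s * _) = _
        rw [ENNReal.ofReal_rpow_of_pos (by positivity), ← mul_assoc,
          ← ENNReal.ofReal_mul (by positivity), Real.inv_rpow h.le,
          mul_inv_cancel₀ (by positivity)]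
        simp

theorem exists_ratio_le [Nonempty S.ι] : ∃ q : ℝ, 0 < q ∧ q < 1 ∧ ∀ i, S.r i ≤ q := by
  obtain ⟨i, hi⟩ := Finite.exists_max S.r
  exact ⟨S.r i, S.r_pos i, S.r_lt_one i, hi⟩

theorem wordRatio_le_pow {q : ℝ} (hq : ∀ i, S.r i ≤ q) (w : List S.ι) :
    S.wordRatio w ≤ q ^ w.length := by
  induction w with
  | nil => simp
  | cons i w ih =>
    rw [wordRatio_cons, List.length_cons, pow_succ']
    exact mul_le_mul (hq i) ih (S.wordRatio_pos w).le ((S.r_pos i).le.trans (hq i))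

theorem compWord_image_subset {O : Set (EuclideanSpace ℝ (Fin d))}
    (hO : ∀ i, S.f i '' O ⊆ O) (w : List S.ι) : S.compWord w '' O ⊆ O := by
  induction w with
  | nil => simp
  | cons i w ih =>
    rw [compWord_cons, image_comp]
    exact (image_mono ih).trans (hO i)

theorem OSCSet.disjoint_compWord_image {S : IFS d} {O : Set (EuclideanSpace ℝ (Fin d))}
    (hO : S.OSCSet O) : ∀ v w : List S.ι, ¬ v <+: w → ¬ w <+: v →
      Disjoint (S.compWord v '' O) (S.compWord w '' O)
  | [], w, h, _ => (h (List.nil_prefix)).elim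
  | _ :: _, [], _, h => (h (List.nil_prefix)).elim
  | i :: v, j :: w, h, h' => by
    rw [compWord_cons, image_comp, compWord_cons, image_comp]
    by_cases hij : i = j
    · subst hij
      rw [disjoint_image_iff (S.injective_f i)]
      refine OSCSet.disjoint_compWord_image hO v w (fun hp => h ?_) (fun hp => h' ?_) <;>
        simpa using hp
    · exact (hO.2.2.2.2 i j hij).mono (image_mono (S.compWord_image_subset hO.2.2.2.1 v))
        (image_mono (S.compWord_image_subset hO.2.2.2.1 w))

/-! ### Existence of the attractor -/

theorem exists_closedBall_invariant [Nonempty S.ι] :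
    ∃ R : ℝ, 0 ≤ R ∧ ∀ i, S.f i '' closedBall 0 R ⊆ closedBall 0 R := by
  obtain ⟨i₀, hi₀⟩ := Finite.exists_max fun i => dist (S.f i 0) 0 / (1 - S.r i)
  have hnn : 0 ≤ dist (S.f i₀ 0) 0 / (1 - S.r i₀) :=
    div_nonneg dist_nonneg (sub_nonneg.2 (S.r_lt_one i₀).le)
  refine ⟨_, hnn, fun i => ?_⟩
  set R := dist (S.f i₀ 0) 0 / (1 - S.r i₀)
  rintro _ ⟨x, hx, rfl⟩
  rw [mem_closedBall] at hx ⊢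
  have h1 : dist (S.f i 0) 0 ≤ R * (1 - S.r i) :=
    (div_le_iff₀ (sub_pos.2 (S.r_lt_one i))).1 (hi₀ i)
  have h2 := dist_triangle (S.f i x) (S.f i 0) 0
  rw [S.sim] at h2
  nlinarith [mul_le_mul_of_nonneg_left hx (S.r_pos i).le]

theorem exists_isAttractor [Nonempty S.ι] : ∃ E, S.IsAttractor E := by
  obtain ⟨R, hR, hinv⟩ := S.exists_closedBall_invariant
  let T : Set (EuclideanSpace ℝ (Fin d)) → Set (EuclideanSpace ℝ (Fin d)) :=
    fun A => ⋃ i, S.f i '' A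
  have hT : Monotone T := fun A B h => iUnion_mono fun i => image_mono h
  let K : ℕ → Set (EuclideanSpace ℝ (Fin d)) := fun n => T^[n] (closedBall 0 R)
  have hK : ∀ n, K (n + 1) = T (K n) := fun n => Function.iterate_succ_apply' T n _
  have hmono : ∀ n, K (n + 1) ⊆ K n := by
    intro n
    induction n with
    | zero => exact iUnion_subset hinv
    | succ n ih => exact (hK (n + 1)).trans_subset ((hT ih).trans_eq (hK n).symm)
  have hanti : Antitone K := antitone_nat_of_succ_le hmono
  have hcomp : ∀ n, IsCompact (K n) := by
    intro n
    induction n with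
    | zero => exact isCompact_closedBall 0 R
    | succ n ih => rw [hK]; exact isCompact_iUnion fun i => ih.image (S.continuous_f i)
  have hne : ∀ n, (K n).Nonempty := by
    intro n
    induction n with
    | zero => exact ⟨0, mem_closedBall_self hR⟩
    | succ n ih =>
      rw [hK]
      exact nonempty_iUnion.2 ⟨Classical.arbitrary _, ih.image _⟩
  refine ⟨⋂ n, K n, ?_, ?_, ?_⟩
  · exact IsCompact.nonempty_iInter_of_sequence_nonempty_isCompact_isClosed K hmono hne (hcomp 0)
      fun n => (hcomp n).isClosed
  · exact (hcomp 0).of_isClosed_subset (isClosed_iInter fun n => (hcomp n).isClosed)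
      (iInter_subset K 0)
  · apply Subset.antisymm
    · intro x hx
      by_contra hcon
      have hex : ∀ i, ∃ n, x ∉ S.f i '' K n := by
        intro i
        by_contra! hall
        apply hcon
        obtain ⟨y, -, hy⟩ := hall 0
        refine mem_iUnion.2 ⟨i, y, mem_iInter.2 fun n => ?_, hy⟩
        obtain ⟨z, hz, hzx⟩ := hall n
        rwa [S.injective_f i (hy.trans hzx.symm)]
      choose n hn using hex
      obtain ⟨N, hN⟩ := Finset.exists_le (Finset.univ.image n)
      have hxN : x ∈ K (N + 1) := mem_iInter.1 hx _
      rw [hK] at hxN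
      obtain ⟨i, hi⟩ := mem_iUnion.1 hxN
      exact hn i (image_mono (hanti (hN _ (Finset.mem_image_of_mem n (Finset.mem_univ i)))) hi)
    · refine iUnion_subset fun i => ?_
      rintro _ ⟨y, hy, rfl⟩
      refine mem_iInter.2 fun n => hmono n ?_
      rw [hK]
      exact mem_iUnion.2 ⟨i, y, mem_iInter.1 hy n, rfl⟩

theorem isAttractor_attractor [Nonempty S.ι] : S.IsAttractor S.attractor := by
  have h := S.exists_isAttractor
  rw [attractor, dif_pos h]
  exact h.choose_spec

section Attractor

variable [Nonempty S.ι]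

theorem attractor_nonempty : S.attractor.Nonempty := S.isAttractor_attractor.1

theorem isCompact_attractor : IsCompact S.attractor := S.isAttractor_attractor.2.1

theorem attractor_eq : S.attractor = ⋃ i, S.f i '' S.attractor := S.isAttractor_attractor.2.2

theorem image_attractor_subset (i : S.ι) : S.f i '' S.attractor ⊆ S.attractor := by
  conv_rhs => rw [S.attractor_eq]
  exact subset_iUnion (fun i => S.f i '' S.attractor) i

theorem compWord_image_attractor_subset (w : List S.ι) :
    S.compWord w '' S.attractor ⊆ S.attractor :=
  S.compWord_image_subset S.image_attractor_subset w

theorem exists_word_mem_image_attractor (n : ℕ) {x : EuclideanSpace ℝ (Fin d)}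
    (hx : x ∈ S.attractor) : ∃ w : List S.ι, w.length = n ∧ x ∈ S.compWord w '' S.attractor := by
  induction n generalizing x with
  | zero => exact ⟨[], rfl, by simpa using hx⟩
  | succ n ih =>
    rw [S.attractor_eq] at hx
    obtain ⟨i, y, hy, rfl⟩ := mem_iUnion.1 hx
    obtain ⟨w, hw, hyw⟩ := ih hy
    exact ⟨i :: w, by simp [hw], by rw [compWord_cons, image_comp]; exact mem_image_of_mem _ hyw⟩

end Attractor

/-! ### Moran's equation -/

theorem exists_moran_exponent [Nonempty S.ι] : ∃ s : ℝ, 0 ≤ s ∧ ∑ i, S.r i ^ s = 1 := by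
  obtain ⟨q, hq0, hq1, hq⟩ := S.exists_ratio_le
  have hcont : Continuous fun s : ℝ => ∑ i, S.r i ^ s :=
    continuous_finsetSum _ fun i _ =>
      continuous_const.rpow continuous_id fun _ => Or.inl (S.r_pos i).ne'
  have hcard : (1 : ℝ) ≤ Fintype.card S.ι := by exact_mod_cast Fintype.card_pos
  obtain ⟨n, hn⟩ := exists_pow_lt_of_lt_one (y := q) (x := (Fintype.card S.ι : ℝ)⁻¹)
    (by positivity) hq1
  have hle : ∑ i, S.r i ^ (n : ℝ) ≤ 1 := by
    calc ∑ i, S.r i ^ (n : ℝ) ≤ ∑ _i : S.ι, (Fintype.card S.ι : ℝ)⁻¹ := by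
          refine Finset.sum_le_sum fun i _ => ?_
          rw [Real.rpow_natCast]
          exact (pow_le_pow_left₀ (S.r_pos i).le (hq i) n).trans hn.le
      _ = 1 := by simp
  obtain ⟨s, hs, hs1⟩ := intermediate_value_Icc' (a := (0 : ℝ)) (b := n) (by positivity)
    hcont.continuousOn ⟨hle, by simpa using hcard⟩
  exact ⟨s, hs.1, hs1⟩

/-! ### Finiteness of the Hausdorff measure of the attractor -/

theorem sum_wordRatio_ofFn_rpow {s : ℝ} (hs : ∑ i, S.r i ^ s = 1) (n : ℕ) :
    ∑ v : Fin n → S.ι, S.wordRatio (List.ofFn v) ^ s = 1 := by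
  have h : ∀ v : Fin n → S.ι, S.wordRatio (List.ofFn v) ^ s = ∏ k, S.r (v k) ^ s := by
    intro v
    rw [wordRatio, List.map_ofFn, List.prod_ofFn,
      Real.finsetProd_rpow _ _ fun k _ => (S.r_pos (v k)).le]
    rfl
  simp_rw [h]
  rw [← Fintype.sum_pow fun i => S.r i ^ s, hs, one_pow]

theorem ediam_compWord_image_le (w : List S.ι) (A : Set (EuclideanSpace ℝ (Fin d))) :
    ediam (S.compWord w '' A) ≤ ENNReal.ofReal (S.wordRatio w) * ediam A :=
  (S.lipschitzWith_compWord w).ediam_image_le A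

section Attractor

variable [Nonempty S.ι]

theorem ediam_attractor_ne_top : ediam S.attractor ≠ ⊤ :=
  S.isCompact_attractor.isBounded.ediam_ne_top

theorem hausdorffMeasure_attractor_ne_top {s : ℝ} (hs0 : 0 ≤ s) (hs : ∑ i, S.r i ^ s = 1) :
    μH[s] S.attractor ≠ ⊤ := by
  obtain ⟨q, hq0, hq1, hq⟩ := S.exists_ratio_le
  have hD := S.ediam_attractor_ne_top
  refine ne_top_of_le_ne_top (ENNReal.rpow_ne_top_of_nonneg hs0 hD) ?_
  have htend : Tendsto (fun n : ℕ => ENNReal.ofReal (q ^ n) * ediam S.attractor) atTop (𝓝 0) := by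
    have h := (ENNReal.tendsto_ofReal (tendsto_pow_atTop_nhds_zero_of_lt_one hq0.le hq1))
    simpa using ENNReal.Tendsto.mul_const h (Or.inr hD)
  refine (Measure.hausdorffMeasure_le_liminf_sum s S.attractor _ htend
    (fun n (v : Fin n → S.ι) => S.compWord (List.ofFn v) '' S.attractor)
    (Eventually.of_forall fun n v => ?_) (Eventually.of_forall fun n x hx => ?_)).trans ?_
  · refine (S.ediam_compWord_image_le _ _).trans ?_
    gcongr
    simpa using S.wordRatio_le_pow hq (List.ofFn v)
  · obtain ⟨w, rfl, hxw⟩ := S.exists_word_mem_image_attractor n hx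
    exact mem_iUnion.2 ⟨w.get, by simpa using hxw⟩
  · refine (liminf_le_liminf (v := fun _ => ediam S.attractor ^ s)
      (Eventually.of_forall fun n => ?_)).trans (by simp)
    calc ∑ v : Fin n → S.ι, ediam (S.compWord (List.ofFn v) '' S.attractor) ^ s
        ≤ ∑ v : Fin n → S.ι,
            ENNReal.ofReal (S.wordRatio (List.ofFn v) ^ s) * ediam S.attractor ^ s := by
          refine Finset.sum_le_sum fun v _ => ?_
          rw [← ENNReal.ofReal_rpow_of_pos (S.wordRatio_pos _), ← ENNReal.mul_rpow_of_nonneg _ _ hs0]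
          gcongr
          exact S.ediam_compWord_image_le _ _
      _ = ediam S.attractor ^ s := by
          rw [← Finset.sum_mul, ← ENNReal.ofReal_sum_of_nonneg, S.sum_wordRatio_ofFn_rpow hs]
          · simp
          · exact fun v _ => Real.rpow_nonneg (S.wordRatio_pos _).le _

end Attractor

/-! ### Coding by infinite words -/

instance : MeasurableSpace S.ι := ⊤

instance : DiscreteMeasurableSpace S.ι := ⟨fun _ => trivial⟩

variable {S} in
/-- The prefix of length `n` of an infinite word. -/
def prefixWord (ω : ℕ → S.ι) (n : ℕ) : List S.ι := (List.range n).map ω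

@[simp]
theorem length_prefixWord (ω : ℕ → S.ι) (n : ℕ) : (prefixWord ω n).length = n := by
  simp [prefixWord]

theorem prefixWord_succ (ω : ℕ → S.ι) (n : ℕ) :
    prefixWord ω (n + 1) = prefixWord ω n ++ [ω n] := by
  simp [prefixWord, List.range_succ]

theorem take_prefixWord (ω : ℕ → S.ι) (m n : ℕ) :
    (prefixWord ω n).take m = prefixWord ω (min m n) := by
  simp [prefixWord, ← List.map_take, List.take_range]

theorem prefixWord_eq_iff (ω ω' : ℕ → S.ι) (n : ℕ) :
    prefixWord ω' n = prefixWord ω n ↔ ∀ k < n, ω' k = ω k := by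
  simp [prefixWord]

theorem measurable_comp_prefixWord {α : Type*} [MeasurableSpace α] (g : List S.ι → α) (n : ℕ) :
    Measurable fun ω : ℕ → S.ι => g (prefixWord ω n) := by
  have h : (fun ω : ℕ → S.ι => g (prefixWord ω n)) =
      (fun v : Fin n → S.ι => g (List.ofFn v)) ∘ fun ω k => ω k := by
    funext ω
    simp only [Function.comp, prefixWord]
    congr 1
    apply List.ext_getElem <;> simp
  rw [h]
  exact (measurable_of_finite _).comp (measurable_pi_lambda _ fun k => measurable_pi_apply _)

theorem wordRatio_prefixWord (ω : ℕ → S.ι) (n : ℕ) :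
    S.wordRatio (prefixWord ω n) = ∏ k ∈ Finset.range n, S.r (ω k) := by
  induction n with
  | zero => rfl
  | succ n ih => rw [prefixWord_succ, wordRatio_append, ih, Finset.prod_range_succ]; simp

theorem exists_coding_map [Nonempty S.ι] :
    ∃ π : (ℕ → S.ι) → EuclideanSpace ℝ (Fin d), Measurable π ∧
      ∀ ω n, π ω ∈ S.compWord (prefixWord ω n) '' S.attractor := by
  have hcomp : ∀ w, IsCompact (S.compWord w '' S.attractor) := fun w =>
    S.isCompact_attractor.image (S.continuous_compWord w)
  have hex : ∀ ω : ℕ → S.ι,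
      (⋂ n, S.compWord (prefixWord ω n) '' S.attractor).Nonempty := by
    intro ω
    refine IsCompact.nonempty_iInter_of_sequence_nonempty_isCompact_isClosed _ (fun n => ?_)
      (fun n => S.attractor_nonempty.image _) (hcomp _) (fun n => (hcomp _).isClosed)
    rw [prefixWord_succ, compWord_append, image_comp]
    exact image_mono (S.image_attractor_subset (ω n))
  choose π hπ using hex
  have hπ' : ∀ ω n, π ω ∈ S.compWord (prefixWord ω n) '' S.attractor :=
    fun ω n => mem_iInter.1 (hπ ω) n
  refine ⟨π, ?_, hπ'⟩
  obtain ⟨q, hq0, hq1, hq⟩ := S.exists_ratio_le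
  obtain ⟨a, ha⟩ := S.attractor_nonempty
  refine measurable_of_tendsto_metrizable
    (fun n => S.measurable_comp_prefixWord (fun w => S.compWord w a) n)
    (tendsto_pi_nhds.2 fun ω => tendsto_iff_dist_tendsto_zero.2 ?_)
  have htend : Tendsto (fun n : ℕ => q ^ n * Metric.diam S.attractor) atTop (𝓝 0) := by
    simpa using (tendsto_pow_atTop_nhds_zero_of_lt_one hq0.le hq1).mul_const
      (Metric.diam S.attractor)
  refine squeeze_zero (fun _ => dist_nonneg) (fun n => ?_) htend
  obtain ⟨y, hy, hyω⟩ := hπ' ω n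
  rw [← hyω, dist_compWord]
  refine mul_le_mul ?_ (dist_le_diam_of_mem S.isCompact_attractor.isBounded ha hy) dist_nonneg
    (by positivity)
  simpa using S.wordRatio_le_pow hq (prefixWord ω n)

/-- The Bernoulli measure on infinite words with weights `r_i ^ s`. -/
theorem exists_bernoulli_measure {s : ℝ} (hs : ∑ i, S.r i ^ s = 1) :
    ∃ P : Measure (ℕ → S.ι), IsProbabilityMeasure P ∧ ∀ w : List S.ι,
      P {ω | prefixWord ω w.length = w} ≤ ENNReal.ofReal (S.wordRatio w ^ s) := by
  have hsum : ∑ i, ENNReal.ofReal (S.r i ^ s) = 1 := by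
    rw [← ENNReal.ofReal_sum_of_nonneg fun i _ => Real.rpow_nonneg (S.r_pos i).le _, hs]
    simp
  let P₀ : Measure S.ι := (PMF.ofFintype _ hsum).toMeasure
  refine ⟨Measure.infinitePi fun _ : ℕ => P₀, inferInstance, fun w => ?_⟩
  rcases Set.eq_empty_or_nonempty {ω : ℕ → S.ι | prefixWord ω w.length = w} with h | ⟨ω, hω⟩
  · rw [h]; simp
  · have hset : {ω' : ℕ → S.ι | prefixWord ω' w.length = w} =
        Set.pi (Finset.range w.length) fun k => {ω k} := by
      ext ω'
      have hω : prefixWord ω w.length = w := hω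
      have := S.prefixWord_eq_iff ω ω' w.length
      rw [hω] at this
      simp [this]
    have hω : prefixWord ω w.length = w := hω
    rw [hset, Measure.infinitePi_pi _ fun _ _ => MeasurableSet.of_discrete]
    conv_rhs => rw [← hω, wordRatio_prefixWord]
    rw [← Real.finsetProd_rpow _ _ fun k _ => (S.r_pos _).le,
      ENNReal.ofReal_prod_of_nonneg fun k _ => Real.rpow_nonneg (S.r_pos _).le _]
    refine Finset.prod_le_prod' fun k _ => ?_
    rw [PMF.toMeasure_apply_singleton _ _ (MeasurableSet.of_discrete)]
    rfl

/-! ### Words stopped at a given scale -/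

/-- The words whose ratio is at most `ρ` while all their proper prefixes have ratio above `ρ`. -/
def stoppedWords (ρ : ℝ) : Set (List S.ι) :=
  {w | S.wordRatio w ≤ ρ ∧ ∀ v, v <+: w → v ≠ w → ρ < S.wordRatio v}

variable {S} in
theorem eq_of_prefix_of_mem_stoppedWords {ρ : ℝ} {v w : List S.ι} (hv : v ∈ S.stoppedWords ρ)
    (hw : w ∈ S.stoppedWords ρ) (h : v <+: w) : v = w := by
  by_contra hne
  exact (hw.2 v h hne).not_ge hv.1

variable {S} in
theorem mul_le_wordRatio_of_mem_stoppedWords {ρ q : ℝ} (hρ1 : ρ ≤ 1) (hq0 : 0 ≤ q)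
    (hq1 : q ≤ 1) (hq : ∀ i, q ≤ S.r i) {w : List S.ι} (hw : w ∈ S.stoppedWords ρ) :
    ρ * q ≤ S.wordRatio w := by
  rcases List.eq_nil_or_concat w with rfl | ⟨v, i, rfl⟩
  · rw [wordRatio_nil]
    exact mul_le_one₀ hρ1 hq0 hq1
  · rw [List.concat_eq_append] at hw ⊢
    rw [wordRatio_append, wordRatio_singleton]
    exact mul_le_mul (hw.2 v (List.prefix_append _ _) (by simp)).le (hq i) hq0
      (S.wordRatio_pos v).le

theorem exists_prefixWord_mem_stoppedWords [Nonempty S.ι] {ρ : ℝ} (hρ : 0 < ρ) (ω : ℕ → S.ι) :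
    ∃ n, prefixWord ω n ∈ S.stoppedWords ρ := by
  classical
  obtain ⟨q, hq0, hq1, hq⟩ := S.exists_ratio_le
  have hex : ∃ n, S.wordRatio (prefixWord ω n) ≤ ρ := by
    obtain ⟨n, hn⟩ := exists_pow_lt_of_lt_one hρ hq1
    refine ⟨n, (S.wordRatio_le_pow hq _).trans ?_⟩
    simpa using hn.le
  refine ⟨Nat.find hex, Nat.find_spec hex, fun v hv hne => ?_⟩
  rw [List.prefix_iff_eq_take, take_prefixWord] at hv
  rcases lt_or_ge v.length (Nat.find hex) with hlt | hge
  · rw [min_eq_left hlt.le] at hv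
    rw [hv]
    exact not_le.1 (Nat.find_min hex hlt)
  · rw [min_eq_right hge] at hv
    exact (hne hv).elim

/-- Under the open set condition, boundedly many stopped cylinders meet a set of diameter at most
the stopping scale. -/
theorem OSCSet.exists_encard_stoppedWords_le {S : IFS d} [Nonempty S.ι]
    {O : Set (EuclideanSpace ℝ (Fin d))} (hO : S.OSCSet O) :
    ∃ M : ℝ≥0∞, M ≠ ⊤ ∧ ∀ (ρ : ℝ), 0 < ρ → ρ ≤ 1 → ∀ U : Set (EuclideanSpace ℝ (Fin d)),
      (∀ x ∈ U, ∀ y ∈ U, dist x y ≤ ρ) →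
      ({w ∈ S.stoppedWords ρ | (S.compWord w '' S.attractor ∩ U).Nonempty}.encard : ℝ≥0∞) ≤ M := by
  obtain ⟨i₀, hi₀⟩ := Finite.exists_min S.r
  have hq := S.r_pos i₀
  let μ : Measure (EuclideanSpace ℝ (Fin d)) := μH[(d : ℝ)]
  have hμ : μ.IsAddHaarMeasure := by
    simpa using isAddHaarMeasure_hausdorffMeasure (E := EuclideanSpace ℝ (Fin d))
  obtain ⟨D, hD⟩ := Metric.isBounded_iff.1
    (hO.2.2.1.union S.isCompact_attractor.isBounded)
  obtain ⟨o, ho⟩ := hO.1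
  have hD0 : 0 ≤ D := dist_nonneg.trans (hD (Or.inl ho) (Or.inl ho))
  set A : ℝ≥0∞ := ENNReal.ofReal (S.r i₀ ^ d) * μ O with hA
  set B : ℝ≥0∞ := ENNReal.ofReal ((1 + D) ^ d) * μ (ball 0 1) with hB
  have hA0 : A ≠ 0 :=
    mul_ne_zero (by simpa using pow_pos hq d) (hO.2.1.measure_pos μ hO.1).ne'
  have hBtop : B ≠ ⊤ := ENNReal.mul_ne_top ENNReal.ofReal_ne_top measure_ball_lt_top.ne
  refine ⟨B / A, ENNReal.div_ne_top hBtop hA0, fun ρ hρ hρ1 U hU => ?_⟩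
  rcases U.eq_empty_or_nonempty with rfl | ⟨u, hu⟩
  · simp
  set W := {w ∈ S.stoppedWords ρ | (S.compWord w '' S.attractor ∩ U).Nonempty}
  have hmeas : ∀ w : W, MeasurableSet (S.compWord w '' O) := fun w =>
    hO.2.1.measurableSet.image_of_continuousOn_injOn (S.continuous_compWord w).continuousOn
      (S.compWord_injective w).injOn
  have hdisj : Pairwise (Function.onFun Disjoint fun w : W => S.compWord w '' O) := by
    intro v w hvw
    refine hO.disjoint_compWord_image _ _ (fun h => hvw ?_) (fun h => hvw ?_)
    · exact Subtype.ext (eq_of_prefix_of_mem_stoppedWords v.2.1 w.2.1 h)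
    · exact Subtype.ext (eq_of_prefix_of_mem_stoppedWords w.2.1 v.2.1 h).symm
  have hsub : (⋃ w : W, S.compWord w '' O) ⊆ closedBall u ((1 + D) * ρ) := by
    refine iUnion_subset fun w => ?_
    rintro _ ⟨y, hy, rfl⟩
    obtain ⟨_, ⟨e, he, rfl⟩, heU⟩ := w.2.2
    have h1 : dist (S.compWord w y) (S.compWord w e) ≤ ρ * D := by
      rw [dist_compWord]
      exact mul_le_mul w.2.1.1 (hD (Or.inl hy) (Or.inr he)) dist_nonneg hρ.le
    have h2 := hU _ heU _ hu
    rw [mem_closedBall]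
    linarith [dist_triangle (S.compWord w y) (S.compWord w e) u]
  have hlow : ∀ w : W, ENNReal.ofReal (ρ ^ d) * A ≤ μ (S.compWord w '' O) := by
    intro w
    change _ ≤ μH[(d : ℝ)] _
    rw [S.hausdorffMeasure_compWord_image _ (Nat.cast_nonneg d), hA, ← mul_assoc,
      ← ENNReal.ofReal_mul (by positivity), ← mul_pow, Real.rpow_natCast]
    gcongr
    exact mul_le_wordRatio_of_mem_stoppedWords hρ1 hq.le (S.r_lt_one i₀).le hi₀ w.2.1
  have key : (W.encard : ℝ≥0∞) * (ENNReal.ofReal (ρ ^ d) * A) ≤ ENNReal.ofReal (ρ ^ d) * B := by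
    calc (W.encard : ℝ≥0∞) * (ENNReal.ofReal (ρ ^ d) * A)
        = ∑' _ : W, ENNReal.ofReal (ρ ^ d) * A := (ENNReal.tsum_set_const _ _).symm
      _ ≤ ∑' w : W, μ (S.compWord w '' O) := ENNReal.tsum_le_tsum hlow
      _ ≤ μ (⋃ w : W, S.compWord w '' O) := tsum_meas_le_meas_iUnion_of_disjoint μ hmeas hdisj
      _ ≤ μ (closedBall u ((1 + D) * ρ)) := measure_mono hsub
      _ = ENNReal.ofReal (ρ ^ d) * B := by
        rw [Measure.addHaar_closedBall μ u (by positivity), hB, ← mul_assoc,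
          ← ENNReal.ofReal_mul (by positivity), ← mul_pow, mul_comm ρ]
        simp
  have hρd : ENNReal.ofReal (ρ ^ d) ≠ 0 := by simpa using pow_pos hρ d
  rw [mul_left_comm, ENNReal.mul_le_mul_iff_right hρd ENNReal.ofReal_ne_top] at key
  rwa [ENNReal.le_div_iff_mul_le (Or.inl hA0) (Or.inr hBtop)]

/-! ### Positivity of the Hausdorff measure of the attractor -/

theorem hausdorffMeasure_attractor_ne_zero [Nonempty S.ι] (hS : S.OSC) {s : ℝ} (hs0 : 0 ≤ s)
    (hs : ∑ i, S.r i ^ s = 1) : μH[s] S.attractor ≠ 0 := by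
  obtain ⟨O, hO⟩ := hS
  obtain ⟨M, hM, hcount⟩ := hO.exists_encard_stoppedWords_le
  obtain ⟨π, hπ, hπE⟩ := S.exists_coding_map
  obtain ⟨P, hP, hPw⟩ := S.exists_bernoulli_measure hs
  have hscale : ∀ ρ : ℝ, 0 < ρ → ρ ≤ 1 → ∀ U : Set (EuclideanSpace ℝ (Fin d)),
      ediam U ≤ ENNReal.ofReal ρ → P (π ⁻¹' U) ≤ M * ENNReal.ofReal ρ ^ s := by
    intro ρ hρ hρ1 U hU
    have hUdist : ∀ x ∈ U, ∀ y ∈ U, dist x y ≤ ρ := by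
      intro x hx y hy
      have h := (edist_le_ediam_of_mem hx hy).trans hU
      rwa [edist_dist, ENNReal.ofReal_le_ofReal_iff hρ.le] at h
    set W := {w ∈ S.stoppedWords ρ | (S.compWord w '' S.attractor ∩ U).Nonempty} with hW
    calc P (π ⁻¹' U) ≤ P (⋃ w ∈ W, {ω | prefixWord ω w.length = w}) := by
          refine measure_mono fun ω hω => ?_
          obtain ⟨n, hn⟩ := S.exists_prefixWord_mem_stoppedWords hρ ω
          exact mem_biUnion (show prefixWord ω n ∈ W from ⟨hn, π ω, hπE ω n, hω⟩) (by simp)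
      _ ≤ ∑' w : W, P {ω | prefixWord ω (w : List S.ι).length = w} :=
          measure_biUnion_le P W.to_countable _
      _ ≤ ∑' _ : W, ENNReal.ofReal ρ ^ s := by
          refine ENNReal.tsum_le_tsum fun w => (hPw w).trans ?_
          rw [← ENNReal.ofReal_rpow_of_pos (S.wordRatio_pos _)]
          exact ENNReal.rpow_le_rpow (ENNReal.ofReal_le_ofReal w.2.1.1) hs0
      _ = W.encard * ENNReal.ofReal ρ ^ s := ENNReal.tsum_set_const _ _
      _ ≤ M * ENNReal.ofReal ρ ^ s := by
          gcongr
          exact hcount ρ hρ hρ1 U hUdist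
  have hdiam : ∀ U : Set (EuclideanSpace ℝ (Fin d)), ediam U ≤ 2⁻¹ →
      P (π ⁻¹' U) ≤ M * ediam U ^ s := by
    intro U hU
    have hlt : ediam U < 1 := hU.trans_lt (by simp)
    have : NeBot (𝓝[>] ediam U) := nhdsGT_neBot_of_exists_gt ⟨1, hlt⟩
    have htend : Tendsto (fun t : ℝ≥0∞ => M * t ^ s) (𝓝[>] ediam U) (𝓝 (M * ediam U ^ s)) :=
      ((ENNReal.continuous_const_mul hM).comp ENNReal.continuous_rpow_const).continuousAt.tendsto
        |>.mono_left nhdsWithin_le_nhds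
    refine ge_of_tendsto htend ?_
    filter_upwards [Ioo_mem_nhdsGT hlt] with t ht
    have httop : t ≠ ⊤ := (ht.2.trans ENNReal.one_lt_top).ne
    have h := hscale t.toReal (ENNReal.toReal_pos (pos_of_gt ht.1).ne' httop)
      (ENNReal.toReal_le_of_le_ofReal zero_le_one (by simpa using ht.2.le)) U
    rw [ENNReal.ofReal_toReal httop] at h
    exact h ht.1.le
  have hc0 : (M + 1)⁻¹ ≠ 0 := ENNReal.inv_ne_zero.2 (by simpa using hM)
  have hle : (M + 1)⁻¹ • P.map π ≤ μH[s] := by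
    refine Measure.le_hausdorffMeasure s _ 2⁻¹ (by simp) fun U hU => ?_
    rw [← ediam_closure] at hU ⊢
    refine (measure_mono subset_closure).trans ?_
    rw [Measure.smul_apply, Measure.map_apply hπ isClosed_closure.measurableSet, smul_eq_mul,
      ENNReal.inv_mul_le_iff (by simp) (by simpa using hM)]
    refine (hdiam _ hU).trans ?_
    gcongr
    exact le_self_add
  intro hzero
  have h := hle S.attractor
  have huniv : π ⁻¹' S.attractor = univ :=
    eq_univ_of_forall fun ω => by simpa [prefixWord] using hπE ω 0
  rw [hzero, Measure.smul_apply,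
    Measure.map_apply hπ S.isCompact_attractor.isClosed.measurableSet, huniv, measure_univ] at h
  simp at h
  exact hM h

theorem moran_hdim [Nonempty S.ι] (hS : S.OSC) :
    0 ≤ S.hdim ∧ ∑ i, S.r i ^ S.hdim = 1 ∧
      μH[S.hdim] S.attractor ≠ 0 ∧ μH[S.hdim] S.attractor ≠ ⊤ := by
  obtain ⟨s, hs0, hs⟩ := S.exists_moran_exponent
  have h0 := S.hausdorffMeasure_attractor_ne_zero hS hs0 hs
  have htop := S.hausdorffMeasure_attractor_ne_top hs0 hs
  have hdim : S.hdim = s := by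
    lift s to ℝ≥0 using hs0
    rw [hdim, dimH_of_hausdorffMeasure_ne_zero_ne_top h0 htop]
    rfl
  rw [hdim]
  exact ⟨hs0, hs, h0, htop⟩

/-! ### Relatively clopen parts of the attractor -/

/-- `F` is a relatively clopen subset of the attractor. -/
def IsClopenPart (F : Set (EuclideanSpace ℝ (Fin d))) : Prop :=
  F ⊆ S.attractor ∧ IsCompact F ∧ IsCompact (S.attractor \ F)

namespace IsClopenPart

variable {S} {F G : Set (EuclideanSpace ℝ (Fin d))}

theorem measurableSet (hF : S.IsClopenPart F) : MeasurableSet F := hF.2.1.isClosed.measurableSet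

theorem inter (hF : S.IsClopenPart F) (hG : S.IsClopenPart G) : S.IsClopenPart (F ∩ G) := by
  refine ⟨inter_subset_left.trans hF.1, hF.2.1.inter hG.2.1, ?_⟩
  rw [sdiff_inter]
  exact hF.2.2.union hG.2.2

theorem union (hF : S.IsClopenPart F) (hG : S.IsClopenPart G) : S.IsClopenPart (F ∪ G) := by
  refine ⟨union_subset hF.1 hG.1, hF.2.1.union hG.2.1, ?_⟩
  rw [← sdiff_inter_sdiff]
  exact hF.2.2.inter hG.2.2

theorem compl (hF : S.IsClopenPart F) : S.IsClopenPart (S.attractor \ F) :=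
  ⟨sdiff_subset, hF.2.2, by rw [Set.sdiff_sdiff_cancel_left hF.1]; exact hF.2.1⟩

theorem diff (hF : S.IsClopenPart F) (hG : S.IsClopenPart G) : S.IsClopenPart (F \ G) := by
  have h : F \ G = F ∩ (S.attractor \ G) := by
    rw [← inter_sdiff_assoc, inter_eq_left.2 hF.1]
  rw [h]
  exact hF.inter hG.compl

theorem mem_nhdsWithin (hF : S.IsClopenPart F) {x : EuclideanSpace ℝ (Fin d)} (hx : x ∈ F) :
    F ∈ 𝓝[S.attractor] x := by
  refine _root_.mem_nhdsWithin.2 ⟨(S.attractor \ F)ᶜ, hF.2.2.isClosed.isOpen_compl,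
    fun h => h.2 hx, ?_⟩
  rintro y ⟨hy, hyE⟩
  by_contra hyF
  exact hy ⟨hyE, hyF⟩

end IsClopenPart

theorem IsRatioRoot.nonempty {S : IFS d} {r : ℝ} (hr : S.IsRatioRoot r) : Nonempty S.ι := by
  by_contra h
  rw [not_nonempty_iff] at h
  obtain ⟨-, -, lam, -, -, hgcd⟩ := hr
  simp [Finset.univ_eq_empty] at hgcd

section ClopenParts

variable [Nonempty S.ι]

theorem exists_isClopenPart_subset (hS : IsTotallyDisconnected S.attractor)
    {x : EuclideanSpace ℝ (Fin d)} (hx : x ∈ S.attractor) {U : Set (EuclideanSpace ℝ (Fin d))}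
    (hU : IsOpen U) (hxU : x ∈ U) : ∃ F, S.IsClopenPart F ∧ x ∈ F ∧ F ⊆ U := by
  have := totallyDisconnectedSpace_subtype_iff.2 hS
  have := isCompact_iff_compactSpace.1 S.isCompact_attractor
  obtain ⟨V, hV, hxV, hVU⟩ := compact_exists_isClopen_in_isOpen
    (X := S.attractor) (x := ⟨x, hx⟩) (hU.preimage continuous_subtype_val) hxU
  refine ⟨Subtype.val '' V, ⟨?_, ?_, ?_⟩, ⟨_, hxV, rfl⟩, image_subset_iff.2 hVU⟩
  · rintro _ ⟨y, -, rfl⟩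
    exact y.2
  · exact hV.1.isCompact.image continuous_subtype_val
  · have h : S.attractor \ Subtype.val '' V = Subtype.val '' Vᶜ := by
      rw [image_compl_eq_range_sdiff_image Subtype.val_injective, Subtype.range_coe]
    rw [h]
    exact hV.compl.1.isCompact.image continuous_subtype_val

/-- A relatively clopen part contains or avoids every cylinder of a large enough level. -/
theorem IsClopenPart.exists_level {S : IFS d} [Nonempty S.ι]
    {F : Set (EuclideanSpace ℝ (Fin d))} (hF : S.IsClopenPart F) :
    ∃ n, ∀ w : List S.ι, w.length = n →
      S.compWord w '' S.attractor ⊆ F ∨ Disjoint (S.compWord w '' S.attractor) F := by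
  obtain ⟨q, hq0, hq1, hq⟩ := S.exists_ratio_le
  obtain ⟨δ, hδ, hsep⟩ := exists_pos_forall_lt_edist hF.2.1 hF.2.2.isClosed disjoint_sdiff_right
  have htend : Tendsto (fun n : ℕ => q ^ n * Metric.diam S.attractor) atTop (𝓝 0) := by
    simpa using (tendsto_pow_atTop_nhds_zero_of_lt_one hq0.le hq1).mul_const
      (Metric.diam S.attractor)
  obtain ⟨n, hn⟩ := (htend.eventually (gt_mem_nhds (NNReal.coe_pos.2 hδ))).exists
  refine ⟨n, fun w hw => or_iff_not_imp_right.2 fun hnd => ?_⟩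
  obtain ⟨_, ⟨y, hy, rfl⟩, hyF⟩ := not_disjoint_iff.1 hnd
  rintro _ ⟨z, hz, rfl⟩
  by_contra hzF
  have h1 := hsep _ hyF _ ⟨S.compWord_image_attractor_subset w (mem_image_of_mem _ hz), hzF⟩
  rw [edist_nndist, ENNReal.coe_lt_coe, ← NNReal.coe_lt_coe, coe_nndist, dist_compWord] at h1
  have h2 : S.wordRatio w * dist y z ≤ q ^ n * Metric.diam S.attractor :=
    mul_le_mul (hw ▸ S.wordRatio_le_pow hq w)
      (dist_le_diam_of_mem S.isCompact_attractor.isBounded hy hz) dist_nonneg (by positivity)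
  linarith

/-- Relatively clopen parts pull back along cylinder maps to relatively clopen parts. -/
theorem isClopenPart_preimage {F : Set (EuclideanSpace ℝ (Fin d))} (hF : S.IsClopenPart F)
    (w : List S.ι) : S.IsClopenPart (S.compWord w ⁻¹' F ∩ S.attractor) := by
  have hpre : ∀ {A : Set (EuclideanSpace ℝ (Fin d))}, IsCompact A →
      IsCompact (S.compWord w ⁻¹' A ∩ S.attractor) := fun hA =>
    S.isCompact_attractor.inter_left (hA.isClosed.preimage (S.continuous_compWord w))
  refine ⟨inter_subset_right, hpre hF.2.1, ?_⟩
  convert hpre hF.2.2 using 1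
  ext y
  have h : y ∈ S.attractor → S.compWord w y ∈ S.attractor := fun hy =>
    S.compWord_image_attractor_subset w (mem_image_of_mem _ hy)
  simp only [Set.mem_sdiff, mem_inter_iff, mem_preimage]
  tauto

theorem isClopenPart_image {F G : Set (EuclideanSpace ℝ (Fin d))} (hF : S.IsClopenPart F)
    {w : List S.ι} (hFw : F ⊆ S.compWord w '' S.attractor) (hG : S.IsClopenPart G)
    (hGF : S.compWord w '' G ⊆ F) : S.IsClopenPart (S.compWord w '' G) := by
  refine ⟨hGF.trans hF.1, hG.2.1.image (S.continuous_compWord w), ?_⟩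
  have h : S.attractor \ S.compWord w '' G = (S.attractor \ F) ∪
      S.compWord w '' ((S.compWord w ⁻¹' F ∩ S.attractor) \ G) := by
    ext z
    constructor
    · rintro ⟨hz, hzG⟩
      by_cases hzF : z ∈ F
      · obtain ⟨y, hy, rfl⟩ := hFw hzF
        exact Or.inr ⟨y, ⟨⟨hzF, hy⟩, fun hyG => hzG ⟨y, hyG, rfl⟩⟩, rfl⟩
      · exact Or.inl ⟨hz, hzF⟩
    · rintro (⟨hz, hzF⟩ | ⟨y, ⟨⟨hyF, hy⟩, hyG⟩, rfl⟩)
      · exact ⟨hz, fun h => hzF (hGF h)⟩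
      · exact ⟨hF.1 hyF, fun h => hyG (((S.compWord_injective w).mem_set_image).1 h)⟩
  rw [h]
  exact hF.2.2.union (((S.isClopenPart_preimage hF w).diff hG).2.1.image (S.continuous_compWord w))

/-! ### The natural measure -/

theorem natMeasure_attractor (hS : S.OSC) : S.natMeasure S.attractor = 1 := by
  obtain ⟨-, -, h0, htop⟩ := S.moran_hdim hS
  simp [natMeasure, ENNReal.div_self h0 htop]

theorem natMeasure_union (hS : S.OSC) {F G : Set (EuclideanSpace ℝ (Fin d))}
    (hF : F ⊆ S.attractor) (hG : G ⊆ S.attractor) (hGm : MeasurableSet G) (hFG : Disjoint F G) :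
    S.natMeasure (F ∪ G) = S.natMeasure F + S.natMeasure G := by
  obtain ⟨-, -, h0, htop⟩ := S.moran_hdim hS
  have hfin : ∀ {A}, A ⊆ S.attractor → μH[S.hdim] A / μH[S.hdim] S.attractor ≠ ⊤ := fun hA =>
    ENNReal.div_ne_top (ne_top_of_le_ne_top htop (measure_mono hA)) h0
  rw [natMeasure, measure_union hFG hGm, ENNReal.add_div, ENNReal.toReal_add (hfin hF) (hfin hG)]
  rfl

theorem natMeasure_compWord_image (hS : S.OSC) (w : List S.ι)
    (A : Set (EuclideanSpace ℝ (Fin d))) :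
    S.natMeasure (S.compWord w '' A) = S.wordRatio w ^ S.hdim * S.natMeasure A := by
  rw [natMeasure, S.hausdorffMeasure_compWord_image w (S.moran_hdim hS).1, mul_div_assoc,
    ENNReal.toReal_mul, ENNReal.toReal_ofReal (Real.rpow_nonneg (S.wordRatio_pos w).le _)]
  rfl

/-- The first-level cylinders overlap in a null set: the Hausdorff measure of a measurable part is
the sum of the measures of its traces on them. -/
theorem hausdorffMeasure_eq_sum (hS : S.OSC) {F : Set (EuclideanSpace ℝ (Fin d))}
    (hF : F ⊆ S.attractor) (hFm : MeasurableSet F) :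
    μH[S.hdim] F = ∑ i, μH[S.hdim] (S.f i '' S.attractor ∩ F) := by
  obtain ⟨hs0, hs, h0, htop⟩ := S.moran_hdim hS
  have hcover : ∀ A, A ⊆ S.attractor →
      μH[S.hdim] A ≤ ∑ i, μH[S.hdim] (S.f i '' S.attractor ∩ A) := by
    intro A hA
    refine (measure_mono fun x hx => ?_).trans (measure_iUnion_fintype_le _ _)
    rw [← iUnion_inter, ← S.attractor_eq]
    exact ⟨hA hx, hx⟩
  have hsum : ∑ i, μH[S.hdim] (S.f i '' S.attractor ∩ F) +
      ∑ i, μH[S.hdim] (S.f i '' S.attractor ∩ (S.attractor \ F)) = μH[S.hdim] S.attractor := by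
    rw [← Finset.sum_add_distrib]
    calc ∑ i, (μH[S.hdim] (S.f i '' S.attractor ∩ F) +
          μH[S.hdim] (S.f i '' S.attractor ∩ (S.attractor \ F)))
        = ∑ i, ENNReal.ofReal (S.r i ^ S.hdim) * μH[S.hdim] S.attractor := by
          refine Finset.sum_congr rfl fun i _ => ?_
          rw [← inter_sdiff_assoc, inter_eq_left.2 (S.image_attractor_subset i),
            measure_inter_add_sdiff _ hFm]
          simpa [compWord_singleton] using
            S.hausdorffMeasure_compWord_image [i] hs0 S.attractor
      _ = μH[S.hdim] S.attractor := by
          rw [← Finset.sum_mul,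
            ← ENNReal.ofReal_sum_of_nonneg fun i _ => Real.rpow_nonneg (S.r_pos i).le _, hs]
          simp
  refine (hcover F hF).antisymm (not_lt.1 fun hlt => ?_)
  have hlt' := ENNReal.add_lt_add_of_lt_of_le
    (ne_top_of_le_ne_top htop (measure_mono (sdiff_subset (t := F)))) hlt
    (hcover (S.attractor \ F) sdiff_subset)
  rw [hsum, measure_add_sdiff hFm.nullMeasurableSet, union_eq_right.2 hF] at hlt'
  exact hlt'.false

theorem natMeasure_eq_sum (hS : S.OSC) {F : Set (EuclideanSpace ℝ (Fin d))}
    (hF : F ⊆ S.attractor) (hFm : MeasurableSet F) :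
    S.natMeasure F = ∑ i, S.r i ^ S.hdim * S.natMeasure (S.f i ⁻¹' F ∩ S.attractor) := by
  obtain ⟨hs0, hs, h0, htop⟩ := S.moran_hdim hS
  have h : ∀ i, S.r i ^ S.hdim * S.natMeasure (S.f i ⁻¹' F ∩ S.attractor) =
      S.natMeasure (S.f i '' S.attractor ∩ F) := by
    intro i
    have h := S.natMeasure_compWord_image hS [i] (S.f i ⁻¹' F ∩ S.attractor)
    rw [wordRatio_singleton, compWord_singleton, image_preimage_inter, inter_comm F] at h
    exact h.symm
  simp_rw [h]
  rw [natMeasure, S.hausdorffMeasure_eq_sum hS hF hFm, div_eq_mul_inv, Finset.sum_mul,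
    ENNReal.toReal_sum]
  · rfl
  · exact fun i _ => ENNReal.mul_ne_top
      (ne_top_of_le_ne_top htop (measure_mono (inter_subset_right.trans hF)))
      (ENNReal.inv_ne_top.2 h0)

/-! ### The ring generated by the measure root -/

theorem mem_Zring_self (p : ℝ) : p ∈ Zring p := Subring.subset_closure rfl

theorem IsRatioRoot.exists_wordRatio_rpow_eq {S : IFS d} {r : ℝ} (hr : S.IsRatioRoot r) (s : ℝ)
    (w : List S.ι) : ∃ k : ℕ, S.wordRatio w ^ s = (r ^ s) ^ k := by
  obtain ⟨hr0, -, lam, -, hlam, -⟩ := hr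
  induction w with
  | nil => exact ⟨0, by simp⟩
  | cons i w ih =>
    obtain ⟨k, hk⟩ := ih
    refine ⟨lam i + k, ?_⟩
    rw [wordRatio_cons, Real.mul_rpow (S.r_pos i).le (S.wordRatio_pos w).le, hk, hlam, pow_add,
      Real.rpow_pow_comm hr0.le s (lam i)]

/-- The measure root is a unit of the ring it generates. -/
theorem IsRatioRoot.exists_mul_eq_one {S : IFS d} [Nonempty S.ι] {r : ℝ} (hr : S.IsRatioRoot r)
    (hS : S.OSC) : ∃ u ∈ Zring (r ^ S.hdim), u * r ^ S.hdim = 1 := by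
  obtain ⟨hr0, -, lam, hpos, hlam, -⟩ := hr
  refine ⟨∑ i, (r ^ S.hdim) ^ (lam i - 1),
    sum_mem fun i _ => pow_mem (mem_Zring_self _) _, ?_⟩
  rw [← (S.moran_hdim hS).2.1, Finset.sum_mul]
  refine Finset.sum_congr rfl fun i _ => ?_
  rw [← pow_succ, Nat.sub_add_cancel (hpos i), hlam, Real.rpow_pow_comm hr0.le]

theorem IsClopenPart.natMeasure_mem_Zring {S : IFS d} [Nonempty S.ι] {r : ℝ}
    (hr : S.IsRatioRoot r) (hS : S.OSC) {F : Set (EuclideanSpace ℝ (Fin d))}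
    (hF : S.IsClopenPart F) : S.natMeasure F ∈ Zring (r ^ S.hdim) := by
  obtain ⟨n, hn⟩ := hF.exists_level
  induction n generalizing F with
  | zero =>
    rcases hn [] rfl with h | h
    · rw [compWord_nil, image_id] at h
      rw [hF.1.antisymm h, S.natMeasure_attractor hS]
      exact one_mem _
    · rw [compWord_nil, image_id] at h
      rw [subset_empty_iff.1 (h hF.1 subset_rfl), natMeasure]
      simp
  | succ n ih =>
    rw [S.natMeasure_eq_sum hS hF.1 hF.measurableSet]
    refine sum_mem fun i _ => mul_mem ?_ (ih (S.isClopenPart_preimage hF [i]) fun w hw => ?_)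
    · obtain ⟨k, hk⟩ := hr.exists_wordRatio_rpow_eq S.hdim [i]
      rw [wordRatio_singleton] at hk
      rw [hk]
      exact pow_mem (mem_Zring_self _) _
    · have h := hn (i :: w) (by simp [hw])
      rw [compWord_cons, image_comp] at h
      refine h.imp (fun h => ?_) fun h => ?_
      · exact subset_inter (image_subset_iff.1 h) (S.compWord_image_attractor_subset w)
      · exact (disjoint_image_left.1 h).mono_right inter_subset_left

end ClopenParts

/-! ### The ideal generated by the interior separated sets -/

theorem IsClopenPart.exists_mem_idealOf {S : IFS d} [Nonempty S.ι] {r : ℝ}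
    (hr : S.IsRatioRoot r) (hS : S.OSC) {F O : Set (EuclideanSpace ℝ (Fin d))}
    (hF : S.IsClopenPart F) (hO : S.OSCSet O) (hFO : F ⊆ O) :
    ∃ y ∈ S.idealOf (r ^ S.hdim), (y : ℝ) = S.natMeasure F :=
  ⟨⟨S.natMeasure F, hF.natMeasure_mem_Zring hr hS⟩,
    Ideal.subset_span ⟨F, ⟨hF.2.1, hF.1, hF.2.2, O, hO, hFO⟩, rfl⟩, rfl⟩

theorem IsRatioRoot.mem_idealOf_of_compWord {S : IFS d} [Nonempty S.ι] {r : ℝ}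
    (hr : S.IsRatioRoot r) (hS : S.OSC) (w : List S.ι) {G : Set (EuclideanSpace ℝ (Fin d))}
    (h : ∃ y ∈ S.idealOf (r ^ S.hdim), (y : ℝ) = S.natMeasure (S.compWord w '' G)) :
    ∃ y ∈ S.idealOf (r ^ S.hdim), (y : ℝ) = S.natMeasure G := by
  obtain ⟨y, hy, hyG⟩ := h
  obtain ⟨u, hu, hup⟩ := hr.exists_mul_eq_one hS
  obtain ⟨k, hk⟩ := hr.exists_wordRatio_rpow_eq S.hdim w
  refine ⟨⟨u, hu⟩ ^ k * y, Ideal.mul_mem_left _ _ hy, ?_⟩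
  rw [S.natMeasure_compWord_image hS, hk] at hyG
  push_cast
  rw [hyG, ← mul_assoc, ← mul_pow, hup, one_pow, one_mul]

/-- Near every point, relatively clopen parts have natural measure in the ideal, provided that the
boundary points are separated. -/
theorem exists_isClopenPart_forall_mem_idealOf [Nonempty S.ι] (hS : S.MemTOEC) {r : ℝ}
    (hr : S.IsRatioRoot r) (hsep : ∀ x ∈ S.boundary, S.SeparatedPt x)
    {x : EuclideanSpace ℝ (Fin d)} (hx : x ∈ S.attractor) :
    ∃ F, S.IsClopenPart F ∧ x ∈ F ∧ ∀ G, S.IsClopenPart G → G ⊆ F →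
      ∃ y ∈ S.idealOf (r ^ S.hdim), (y : ℝ) = S.natMeasure G := by
  have hint : ∀ z ∈ S.attractor, z ∉ S.boundary → ∃ O, S.OSCSet O ∧ z ∈ O := by
    intro z hz hzb
    have h : z ∈ ⋃ O ∈ {O | S.OSCSet O}, O := by
      by_contra h
      exact hzb ⟨hz, h⟩
    obtain ⟨O, hO, hzO⟩ := mem_iUnion₂.1 h
    exact ⟨O, hO, hzO⟩
  by_cases hxb : x ∈ S.boundary
  · obtain ⟨w, hwb, hw⟩ := hsep x hxb
    have hwx : S.compWord w x ∈ S.attractor :=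
      S.compWord_image_attractor_subset w (mem_image_of_mem _ hx)
    obtain ⟨O, hO, hwO⟩ := hint _ hwx hwb
    set T : Set (List S.ι) := {v | v.length = w.length} \ {w}
    have hT : T.Finite := (List.finite_length_eq S.ι w.length).subset sdiff_subset
    have hC : IsClosed (⋃ v ∈ T, S.compWord v '' S.attractor) :=
      hT.isClosed_biUnion fun v _ =>
        (S.isCompact_attractor.image (S.continuous_compWord v)).isClosed
    obtain ⟨F, hF, hxF, hFU⟩ := S.exists_isClopenPart_subset hS.2.2 hwx
      (hO.2.1.inter hC.isOpen_compl) ⟨hwO, fun h => by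
        obtain ⟨v, hv, hxv⟩ := mem_iUnion₂.1 h
        exact hw v hv.1 hv.2 hxv⟩
    have hFw : F ⊆ S.compWord w '' S.attractor := by
      intro z hz
      obtain ⟨v, hv, hzv⟩ := S.exists_word_mem_image_attractor w.length (hF.1 hz)
      by_cases hvw : v = w
      · exact hvw ▸ hzv
      · exact ((hFU hz).2 (mem_biUnion (show v ∈ T from ⟨hv, hvw⟩) hzv)).elim
    refine ⟨_, S.isClopenPart_preimage hF w, ⟨hxF, hx⟩, fun G hG hGF => ?_⟩
    have hGF' : S.compWord w '' G ⊆ F := image_subset_iff.2 (hGF.trans inter_subset_left)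
    exact hr.mem_idealOf_of_compWord hS.1 w
      ((S.isClopenPart_image hF hFw hG hGF').exists_mem_idealOf hr hS.1 hO
        (hGF'.trans (hFU.trans inter_subset_left)))
  · obtain ⟨O, hO, hxO⟩ := hint x hx hxb
    obtain ⟨F, hF, hxF, hFO⟩ := S.exists_isClopenPart_subset hS.2.2 hx hO.2.1 hxO
    exact ⟨F, hF, hxF, fun G hG hGF => hG.exists_mem_idealOf hr hS.1 hO (hGF.trans hFO)⟩

end IFS

/-- **Theorem.** Let `S ∈ TOEC`. If every point of `∂_S` is separated, then
`I_S = ℤ[p_S]`. -/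
theorem idealOf_eq_top_of_separated {d : ℕ} (S : IFS d) (hS : S.MemTOEC)
    (r : ℝ) (hr : S.IsRatioRoot r)
    (hsep : ∀ x ∈ S.boundary, S.SeparatedPt x) :
    S.idealOf (r ^ S.hdim) = ⊤ := by
  have := hr.nonempty
  let p : Set (EuclideanSpace ℝ (Fin d)) → Prop := fun A =>
    ∃ F, S.IsClopenPart F ∧ A ⊆ F ∧ ∀ G, S.IsClopenPart G → G ⊆ F →
      ∃ y ∈ S.idealOf (r ^ S.hdim), (y : ℝ) = S.natMeasure G
  have hp : p S.attractor := by
    refine S.isCompact_attractor.induction_on ?_ ?_ ?_ ?_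
    · refine ⟨∅, ⟨empty_subset _, isCompact_empty, by simpa using S.isCompact_attractor⟩,
        subset_rfl, fun G _ hG => ⟨0, zero_mem _, ?_⟩⟩
      simp [subset_empty_iff.1 hG, IFS.natMeasure]
    · rintro A B hAB ⟨F, hF, hBF, h⟩
      exact ⟨F, hF, hAB.trans hBF, h⟩
    · rintro A B ⟨F, hF, hAF, h⟩ ⟨F', hF', hBF', h'⟩
      refine ⟨F ∪ F', hF.union hF', union_subset_union hAF hBF', fun G hG hGF => ?_⟩
      obtain ⟨y, hy, hyG⟩ := h _ (hG.inter hF) inter_subset_right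
      obtain ⟨z, hz, hzG⟩ := h' _ (hG.diff hF) (sdiff_subset_iff.2 hGF)
      refine ⟨y + z, add_mem hy hz, ?_⟩
      have hadd := S.natMeasure_union hS.1 (hG.inter hF).1 (hG.diff hF).1
        (hG.diff hF).measurableSet disjoint_inf_sdiff
      rw [inter_union_sdiff] at hadd
      rw [hadd, ← hyG, ← hzG]
      rfl
    · intro x hx
      obtain ⟨F, hF, hxF, h⟩ := S.exists_isClopenPart_forall_mem_idealOf hS hr hsep hx
      exact ⟨F, hF.mem_nhdsWithin hxF, F, hF, subset_rfl, h⟩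
  obtain ⟨F, -, hEF, h⟩ := hp
  obtain ⟨y, hy, hyE⟩ := h S.attractor
    ⟨subset_rfl, S.isCompact_attractor, by simp⟩ hEF
  rw [S.natMeasure_attractor hS.1] at hyE
  rw [Ideal.eq_top_iff_one]
  rwa [show y = 1 from Subtype.ext hyE] at hy

end
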